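/- arXiv:1901.02045 — 3 statements merged into one kernel-verified Lean document; each statement's English description precedes it below -/
import Mathlib

section
/- Let d ≥ 1, let (Ω,𝓕,ℙ) be a probability space carrying an ℝ^d-valued random vector X and a real random variable Z with values in (0,1], with X and Z independent. Let θ0 ∈ ℝ^d and suppose e^{θ0·X} is integrable. Define F(u) = u·ℙ(Z ≥ u) for u ≥ 0 and let z* ≥ 0 satisfy F(z*) ≥ F(u) for all u ≥ 0. Then for every measurable pricing function p : ℝ^d → [0,∞), E[ p(X) · 1{Z·e^{θ0·X} ≥ p(X)} ] ≤ F(z*) · E[e^{θ0·X}]. -/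
open MeasureTheory ProbabilityTheory

/-- The Oracle optimality inequality: for the valuation model `V = Z · exp(θ0 ⬝ X)`
with `Z ∈ (0,1]` independent of `X`, no measurable nonnegative pricing rule `p`
earns more than `F(z*) · E[exp(θ0 ⬝ X)]`, where `F(u) = u · ℙ(Z ≥ u)` and `z*`
maximizes `F` over `[0,∞)`. -/
theorem stmt_0
    {d : ℕ} (hd : 1 ≤ d)
    {Ω : Type*} [MeasureSpace Ω] [IsProbabilityMeasure (ℙ : Measure Ω)]
    (X : Ω → (Fin d → ℝ)) (Z : Ω → ℝ)
    (hX : Measurable X) (hZ : Measurable Z)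
    (hZrange : ∀ ω, Z ω ∈ Set.Ioc (0 : ℝ) 1)
    (hindep : IndepFun X Z)
    (θ0 : Fin d → ℝ)
    (hint : Integrable (fun ω => Real.exp (∑ i, θ0 i * X ω i)))
    (F : ℝ → ℝ) (hF : ∀ u, F u = u * (ℙ {ω | u ≤ Z ω}).toReal)
    (zstar : ℝ) (hzstar : 0 ≤ zstar)
    (hopt : ∀ u, 0 ≤ u → F u ≤ F zstar)
    (p : (Fin d → ℝ) → ℝ) (hp : Measurable p) (hpnn : ∀ x, 0 ≤ p x) :
    ∫ ω, (if p (X ω) ≤ Z ω * Real.exp (∑ i, θ0 i * X ω i) then p (X ω) else 0)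
      ≤ F zstar * ∫ ω, Real.exp (∑ i, θ0 i * X ω i) := by
  set E : (Fin d → ℝ) → ℝ := fun x => Real.exp (∑ i, θ0 i * x i) with hE
  have hEpos : ∀ x, 0 < E x := fun x => Real.exp_pos _
  have hEm : Measurable E := by
    simp only [hE]
    fun_prop
  set g : (Fin d → ℝ) × ℝ → ℝ := fun q => if p q.1 ≤ q.2 * E q.1 then p q.1 else 0 with hg
  have hgm : Measurable g := by
    refine Measurable.ite (measurableSet_le ?_ ?_) ?_ measurable_const
    · exact hp.comp measurable_fst
    · exact measurable_snd.mul (hEm.comp measurable_fst)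
    · exact hp.comp measurable_fst
  have hint' : Integrable (fun ω => E (X ω)) := hint
  have hgi : Integrable (fun ω => g (X ω, Z ω)) := by
    refine hint'.mono' (hgm.comp (hX.prodMk hZ)).aestronglyMeasurable (ae_of_all _ fun ω => ?_)
    have h1 := hZrange ω
    have h2 := hEpos (X ω)
    have h3 := hpnn (X ω)
    simp only [hg]
    split_ifs with h
    · rw [Real.norm_of_nonneg h3]
      nlinarith [h1.2]
    · simpa using h2.le
  have hXZ : Measurable (fun ω => (X ω, Z ω)) := hX.prodMk hZ
  have hmap := (indepFun_iff_map_prod_eq_prod_map_map hX.aemeasurable hZ.aemeasurable).1 hindep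
  have : IsProbabilityMeasure (Measure.map X ℙ) := Measure.isProbabilityMeasure_map hX.aemeasurable
  have : IsProbabilityMeasure (Measure.map Z ℙ) := Measure.isProbabilityMeasure_map hZ.aemeasurable
  have hgi2 : Integrable g ((Measure.map X ℙ).prod (Measure.map Z ℙ)) := by
    rw [← hmap]
    exact (integrable_map_measure hgm.aestronglyMeasurable hXZ.aemeasurable).2 hgi
  have hEi : Integrable E (Measure.map X ℙ) :=
    (integrable_map_measure hEm.aestronglyMeasurable hX.aemeasurable).2 hint'
  have hin : ∀ x, ∫ z, g (x, z) ∂(Measure.map Z ℙ) ≤ F zstar * E x := by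
    intro x
    have hx := hEpos x
    have hs : MeasurableSet {z : ℝ | p x / E x ≤ z} := measurableSet_Ici
    have h1 : (fun z => g (x, z)) = Set.indicator {z : ℝ | p x / E x ≤ z} (fun _ => p x) := by
      funext z
      simp only [hg, Set.indicator, Set.mem_setOf_eq, div_le_iff₀ hx]
    rw [h1, integral_indicator_const _ hs, measureReal_def, Measure.map_apply hZ hs]
    have h2 := hopt (p x / E x) (div_nonneg (hpnn x) hx.le)
    rw [hF (p x / E x)] at h2
    have h3 := mul_le_mul_of_nonneg_right h2 hx.le
    refine le_trans (le_of_eq ?_) h3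
    simp only [Set.preimage_setOf_eq, smul_eq_mul]
    field_simp
  calc ∫ ω, g (X ω, Z ω) = ∫ q, g q ∂(Measure.map (fun ω => (X ω, Z ω)) ℙ) :=
        (integral_map hXZ.aemeasurable hgm.aestronglyMeasurable).symm
    _ = ∫ x, ∫ z, g (x, z) ∂(Measure.map Z ℙ) ∂(Measure.map X ℙ) := by
        rw [hmap, integral_prod _ hgi2]
    _ ≤ ∫ x, F zstar * E x ∂(Measure.map X ℙ) :=
        integral_mono hgi2.integral_prod_left (hEi.const_mul _) hin
    _ = F zstar * ∫ ω, E (X ω) := by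
        rw [integral_const_mul, integral_map hX.aemeasurable hEm.aestronglyMeasurable]
end

section
/- Let d ≥ 1, let X be an ℝ^d-valued random vector and Z an independent random variable uniformly distributed on [0,1], and let φ : [0,∞) → ℝ be a function such that E[e^{η·X}] = φ(‖η‖₂²) for every η ∈ ℝ^d (in particular all these exponential moments are finite). Let θ0, θ ∈ ℝ^d and let z ∈ [0,1] satisfy z·e^{(θ−θ0)·X} ≤ 1 almost surely. Then z · E[ e^{θ·X} · 1{Z·e^{θ0·X} > z·e^{θ·X}} ] = z·φ(‖θ‖₂²) − z²·φ(‖2θ − θ0‖₂²). -/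
open MeasureTheory ProbabilityTheory

/-- Closed form of the revenue function for a covariate vector whose exponential
moments depend only on the squared Euclidean norm (e.g. a spherical distribution):
`r(z,θ) = z·φ(‖θ‖₂²) − z²·φ(‖2θ−θ0‖₂²)`. -/
theorem stmt_6
    {d : ℕ} (hd : 1 ≤ d)
    {Ω : Type*} [MeasureSpace Ω] [IsProbabilityMeasure (ℙ : Measure Ω)]
    (X : Ω → (Fin d → ℝ)) (Z : Ω → ℝ)
    (hX : Measurable X) (hZ : Measurable Z)
    (hindep : IndepFun X Z)
    (hunif : Measure.map Z ℙ = (volume : Measure ℝ).restrict (Set.Icc 0 1))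
    (φ : ℝ → ℝ)
    (hφ : ∀ η : Fin d → ℝ,
      Integrable (fun ω => Real.exp (∑ i, η i * X ω i)) ∧
      (∫ ω, Real.exp (∑ i, η i * X ω i)) = φ (∑ i, (η i) ^ 2))
    (θ0 θ : Fin d → ℝ)
    (z : ℝ) (hz : z ∈ Set.Icc (0 : ℝ) 1)
    (hzle : ∀ᵐ ω ∂ℙ, z * Real.exp (∑ i, (θ i - θ0 i) * X ω i) ≤ 1) :
    z * ∫ ω, (if z * Real.exp (∑ i, θ i * X ω i)
                < Z ω * Real.exp (∑ i, θ0 i * X ω i)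
              then Real.exp (∑ i, θ i * X ω i) else 0)
      = z * φ (∑ i, (θ i) ^ 2) - z ^ 2 * φ (∑ i, (2 * θ i - θ0 i) ^ 2) := by
  have hidx : ∀ ω, z * Real.exp (∑ i, θ i * X ω i) = z * Real.exp (∑ i, (θ i - θ0 i) * X ω i) *
      Real.exp (∑ i, θ0 i * X ω i) := by
    intro ω
    rw [mul_assoc, ← Real.exp_add, ← Finset.sum_add_distrib]
    congr 3
    funext i
    ring
  have hprod : Measure.map (fun ω => (X ω, Z ω)) ℙ
      = (Measure.map X ℙ).prod ((volume : Measure ℝ).restrict (Set.Icc 0 1)) := by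
    rw [← hunif]
    exact (indepFun_iff_map_prod_eq_prod_map_map hX.aemeasurable hZ.aemeasurable).1 hindep
  have hms : ∀ η : Fin d → ℝ, Measurable (fun x : Fin d → ℝ => Real.exp (∑ i, η i * x i)) := by
    intro η
    fun_prop
  let F : (Fin d → ℝ) × ℝ → ℝ := fun p =>
    if z * Real.exp (∑ i, θ i * p.1 i) < p.2 * Real.exp (∑ i, θ0 i * p.1 i)
      then Real.exp (∑ i, θ i * p.1 i) else 0
  have hF : Measurable F := by
    refine Measurable.ite (measurableSet_lt ?_ ?_) ?_ measurable_const <;> fun_prop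
  have hXZ : Measurable (fun ω => (X ω, Z ω)) := hX.prodMk hZ
  have hFint : Integrable (fun ω => F (X ω, Z ω)) := by
    refine (hφ θ).1.mono (hF.comp hXZ).aestronglyMeasurable (Filter.Eventually.of_forall ?_)
    intro ω
    simp only [F]
    split_ifs
    · exact le_rfl
    · simp [(Real.exp_pos _).le]
  have hFint2 : Integrable F (Measure.map (fun ω => (X ω, Z ω)) ℙ) :=
    (integrable_map_measure hF.aestronglyMeasurable hXZ.aemeasurable).2 hFint
  have h1 : ∫ ω, F (X ω, Z ω) = ∫ ω, ∫ t in Set.Icc (0:ℝ) 1, F (X ω, t) := by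
    rw [← integral_map (f := F) hXZ.aemeasurable hF.aestronglyMeasurable]
    rw [hprod] at hFint2 ⊢
    rw [integral_prod _ hFint2]
    exact integral_map hX.aemeasurable hFint2.integral_prod_left.aestronglyMeasurable
  have h2 : ∀ᵐ ω ∂ℙ, ∫ t in Set.Icc (0:ℝ) 1, F (X ω, t) =
      Real.exp (∑ i, θ i * X ω i) - z * Real.exp (∑ i, (2 * θ i - θ0 i) * X ω i) := by
    filter_upwards [hzle] with ω hω
    have ha0 : 0 ≤ z * Real.exp (∑ i, (θ i - θ0 i) * X ω i) := mul_nonneg hz.1 (Real.exp_pos _).le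
    have hsum : Real.exp (∑ i, (2 * θ i - θ0 i) * X ω i) =
        Real.exp (∑ i, (θ i - θ0 i) * X ω i) * Real.exp (∑ i, θ i * X ω i) := by
      rw [← Real.exp_add, ← Finset.sum_add_distrib]
      congr 2
      funext i
      ring
    have hFe : (fun t => F (X ω, t)) =
        (Set.Ioi (z * Real.exp (∑ i, (θ i - θ0 i) * X ω i))).indicator
          (fun _ => Real.exp (∑ i, θ i * X ω i)) := by
      funext t
      simp only [F, Set.indicator, Set.mem_Ioi]
      rw [hidx ω]
      simp only [mul_lt_mul_iff_left₀ (Real.exp_pos _)]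
    rw [hFe, setIntegral_indicator measurableSet_Ioi, hsum]
    rw [← mul_assoc]
    generalize z * Real.exp (∑ i, (θ i - θ0 i) * X ω i) = a at hω ha0 ⊢
    have hset : Set.Icc (0:ℝ) 1 ∩ Set.Ioi a = Set.Ioc a 1 := by
      ext t
      simp only [Set.mem_inter_iff, Set.mem_Icc, Set.mem_Ioi, Set.mem_Ioc]
      constructor
      · rintro ⟨⟨_, h⟩, hb⟩
        exact ⟨hb, h⟩
      · rintro ⟨h, hb⟩
        exact ⟨⟨by linarith, hb⟩, h⟩
    rw [hset, setIntegral_const, Real.volume_real_Ioc_of_le hω, smul_eq_mul]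
    ring
  have h3 := integral_congr_ae h2
  rw [integral_sub (hφ θ).1 ((hφ (fun i => 2 * θ i - θ0 i)).1.const_mul z), integral_const_mul,
    (hφ θ).2, (hφ (fun i => 2 * θ i - θ0 i)).2] at h3
  change z * ∫ ω, F (X ω, Z ω) = _
  rw [h1, h3]
  ring
end

section
/- Let d ≥ 1, let X be an ℝ^d-valued random vector and Z an independent random variable uniformly distributed on [0,1], and let θ0 ∈ ℝ^d with e^{θ0·X} integrable. Then for every z ≥ 0 and every θ ∈ ℝ^d, z · E[ e^{θ·X} · 1{Z·e^{θ0·X} > z·e^{θ·X}} ] ≤ (1/4)·E[e^{θ0·X}], and equality holds at (z,θ) = (1/2, θ0), i.e. (1/2)·E[ e^{θ0·X} · 1{Z > 1/2} ] = (1/4)·E[e^{θ0·X}]. -/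
open MeasureTheory ProbabilityTheory

lemma aux_inner (a b : ℝ) (ha : 0 ≤ a) :
    ∫ y in Set.Icc (0:ℝ) 1, (if a < y then b else 0) = b * max (1 - a) 0 := by
  have h : (fun y : ℝ => if a < y then b else 0) = (Set.Ioi a).indicator (fun _ => b) := by
    funext y
    simp [Set.indicator_apply]
  rw [h, integral_indicator measurableSet_Ioi, Measure.restrict_restrict measurableSet_Ioi]
  have h2 : Set.Ioi a ∩ Set.Icc (0:ℝ) 1 = Set.Ioc a 1 := by
    ext y
    simp only [Set.mem_inter_iff, Set.mem_Ioi, Set.mem_Icc, Set.mem_Ioc]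
    constructor
    · rintro ⟨h1, h2, h3⟩
      exact ⟨h1, h3⟩
    · rintro ⟨h1, h3⟩
      exact ⟨h1, by linarith, h3⟩
  rw [h2, integral_const, smul_eq_mul, measureReal_restrict_apply_univ, Real.volume_real_Ioc,
    mul_comm]

lemma aux_main {E Ω : Type*} [MeasurableSpace E] [MeasurableSpace Ω] (P : Measure Ω)
    [IsProbabilityMeasure P] (X : Ω → E) (Z : Ω → ℝ)
    (hX : Measurable X) (hZ : Measurable Z)
    (hindep : IndepFun X Z P)
    (hunif : Measure.map Z P = (volume : Measure ℝ).restrict (Set.Icc 0 1))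
    (f g : E → ℝ) (hf : Measurable f) (hg : Measurable g) (hf0 : ∀ x, 0 ≤ f x)
    (hg0 : ∀ x, 0 < g x) (hint : Integrable (fun ω => g (X ω)) P) :
    ∫ ω, (if f (X ω) < Z ω * g (X ω) then f (X ω) else 0) ∂P
      = ∫ ω, f (X ω) * max (1 - f (X ω) / g (X ω)) 0 ∂P := by
  have hprod := (indepFun_iff_map_prod_eq_prod_map_map hX.aemeasurable hZ.aemeasurable).1 hindep
  haveI : IsProbabilityMeasure (Measure.map X P) :=
    Measure.isProbabilityMeasure_map hX.aemeasurable
  let F : E × ℝ → ℝ := fun p => if f p.1 < p.2 * g p.1 then f p.1 else 0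
  have hF : Measurable F :=
    Measurable.ite (measurableSet_lt (by fun_prop) (by fun_prop)) (by fun_prop) (by fun_prop)
  have hZb : ∀ᵐ ω ∂P, Z ω ∈ Set.Icc (0:ℝ) 1 := by
    apply ae_of_ae_map hZ.aemeasurable
    rw [hunif]
    exact ae_restrict_mem measurableSet_Icc
  have hI : Integrable (fun ω => F (X ω, Z ω)) P := by
    refine hint.mono' (hF.comp (hX.prodMk hZ)).aestronglyMeasurable ?_
    filter_upwards [hZb] with ω hω
    simp only [F]
    split_ifs with h
    · rw [Real.norm_of_nonneg (hf0 _)]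
      nlinarith [hω.2, hg0 (X ω)]
    · simpa using (hg0 _).le
  have hI2 : Integrable F ((Measure.map X P).prod (Measure.map Z P)) := by
    rw [← hprod]
    exact (integrable_map_measure hF.aestronglyMeasurable (hX.prodMk hZ).aemeasurable).2 hI
  have e1 : ∫ ω, F (X ω, Z ω) ∂P = ∫ p, F p ∂((Measure.map X P).prod (Measure.map Z P)) := by
    rw [← hprod, integral_map (hX.prodMk hZ).aemeasurable hF.aestronglyMeasurable]
  have e2 : ∀ x, ∫ y, F (x, y) ∂(Measure.map Z P) = f x * max (1 - f x / g x) 0 := by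
    intro x
    rw [hunif, ← aux_inner _ _ (div_nonneg (hf0 x) (hg0 x).le)]
    simp only [F, div_lt_iff₀ (hg0 x)]
  have hm : Measurable (fun x => f x * max (1 - f x / g x) 0) := by fun_prop
  change ∫ ω, F (X ω, Z ω) ∂P = _
  haveI : IsProbabilityMeasure (Measure.map Z P) :=
    Measure.isProbabilityMeasure_map hZ.aemeasurable
  rw [e1, integral_prod _ hI2]
  simp only [e2]
  rw [integral_map hX.aemeasurable hm.aestronglyMeasurable]

/-- With uniform residual `Z`, the revenue function satisfies
`r(z,θ) ≤ (1/4)·E[e^{θ0·X}]` for all `z ≥ 0` and `θ`, with equality at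
`(z,θ) = (1/2,θ0)`: `(1/2)·E[e^{θ0·X}·1{Z > 1/2}] = (1/4)·E[e^{θ0·X}]`. -/
theorem stmt_12
    {d : ℕ} (hd : 1 ≤ d)
    {Ω : Type*} [MeasureSpace Ω] [IsProbabilityMeasure (ℙ : Measure Ω)]
    (X : Ω → (Fin d → ℝ)) (Z : Ω → ℝ)
    (hX : Measurable X) (hZ : Measurable Z)
    (hindep : IndepFun X Z)
    (hunif : Measure.map Z ℙ = (volume : Measure ℝ).restrict (Set.Icc 0 1))
    (θ0 : Fin d → ℝ)
    (hint : Integrable (fun ω => Real.exp (∑ i, θ0 i * X ω i))) :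
    (∀ z : ℝ, 0 ≤ z → ∀ θ : Fin d → ℝ,
      z * ∫ ω, (if z * Real.exp (∑ i, θ i * X ω i)
                  < Z ω * Real.exp (∑ i, θ0 i * X ω i)
                then Real.exp (∑ i, θ i * X ω i) else 0)
        ≤ (1 / 4) * ∫ ω, Real.exp (∑ i, θ0 i * X ω i)) ∧
    (1 / 2) * (∫ ω, (if (1 / 2 : ℝ) < Z ω then Real.exp (∑ i, θ0 i * X ω i) else 0))
      = (1 / 4) * ∫ ω, Real.exp (∑ i, θ0 i * X ω i) := by
  have hg : Measurable (fun x : Fin d → ℝ => Real.exp (∑ i, θ0 i * x i)) := by fun_prop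
  have hle : ∀ a b : ℝ, 0 ≤ a → 0 < b → a * max (1 - a / b) 0 ≤ 1 / 4 * b := by
    intro a b ha hb
    obtain ⟨t, rfl⟩ : ∃ t, a = t * b := ⟨a / b, by field_simp⟩
    rw [mul_div_cancel_right₀ _ hb.ne']
    rcases max_cases (1 - t) 0 with h | h
    · rw [h.1]
      nlinarith [mul_nonneg hb.le (sq_nonneg (t - 1 / 2))]
    · rw [h.1]
      linarith
  constructor
  · intro z hz θ
    have hf : Measurable (fun x : Fin d → ℝ => z * Real.exp (∑ i, θ i * x i)) := by fun_prop
    have key := aux_main ℙ X Z hX hZ hindep hunif _ _ hf hg (fun x => by positivity)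
      (fun x => by positivity) hint
    rw [← integral_const_mul, ← integral_const_mul]
    simp only [mul_ite, mul_zero]
    rw [key]
    refine integral_mono_of_nonneg (Filter.Eventually.of_forall fun ω => ?_)
      (hint.const_mul _) (Filter.Eventually.of_forall fun ω => ?_)
    · simp only [Pi.zero_apply]
      positivity
    · exact hle _ _ (by positivity) (by positivity)
  · have hf : Measurable (fun x : Fin d → ℝ => 1 / 2 * Real.exp (∑ i, θ0 i * x i)) := by fun_prop
    have key := aux_main ℙ X Z hX hZ hindep hunif _ _ hf hg (fun x => by positivity)
      (fun x => by positivity) hint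
    rw [← integral_const_mul, ← integral_const_mul]
    simp only [mul_lt_mul_iff_left₀ (Real.exp_pos _)] at key
    simp only [mul_ite, mul_zero]
    rw [key]
    congr 1
    funext ω
    rw [mul_div_cancel_right₀ _ (Real.exp_pos _).ne', max_eq_left (by norm_num)]
    ring
end
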